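/- arXiv:1805.01673 — 2 statements merged into one kernel-verified Lean document; each statement's English description precedes it below -/
import Mathlib

section
/- Let k > 0 and 0 ≤ ε₁ < k/2. Let R : ℝ → (ℝⁿ →L[ℝ] ℝⁿ) be continuous with ‖R(t) − k·id‖ ≤ ε₁ (operator norm) for all t ∈ [0, π/√k], and let y : ℝ → ℝⁿ be twice differentiable with y''(t) + R(t) y(t) = 0 on [0, π/√k]. Define ȳ(t) = cos(√k t)·y(0) + (sin(√k t)/√k)·y'(0) and u(t) = y(t) − ȳ(t). Then for every t ∈ [0, π/√k]: ‖u(t)‖ ≤ (ε₁ / (k − (1 − cos(√k t))·ε₁)) · ∫₀ᵗ √k·‖ȳ(s)‖·sin(√k (t − s)) ds. -/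
open scoped InnerProductSpace
open Real

theorem mul_cos_le_sin {x : ℝ} (hx0 : 0 ≤ x) (hx : x ≤ π) : x * cos x ≤ sin x := by
  rcases lt_or_ge x (π / 2) with h | h
  · have hc : 0 < cos x := cos_pos_of_mem_Ioo ⟨by linarith [pi_pos], h⟩
    have := le_tan hx0 h
    rwa [tan_eq_sin_div_cos, le_div_iff₀ hc] at this
  · have hc : cos x ≤ 0 := cos_nonpos_of_pi_div_two_le_of_le h (by linarith [pi_pos])
    exact (mul_nonpos_of_nonneg_of_nonpos hx0 hc).trans (sin_nonneg_of_nonneg_of_le_pi hx0 hx)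

theorem sq_mul_cos_le {z : ℝ} (hz : |z| ≤ π / 2) : z ^ 2 * cos z ≤ z * sin z := by
  have key : ∀ z : ℝ, 0 ≤ z → z ≤ π / 2 → z ^ 2 * cos z ≤ z * sin z := fun z h0 h => by
    have := mul_le_mul_of_nonneg_left (mul_cos_le_sin h0 (by linarith)) h0
    linarith
  obtain ⟨h1, h2⟩ := abs_le.1 hz
  rcases le_total 0 z with h | h
  · exact key z h h2
  · simpa using key (-z) (by linarith) (by linarith)

/-- `x cot x` is decreasing on `[0, π]`, in a form free of divisions. -/
theorem mul_cos_mul_sin_le {x y : ℝ} (hx : 0 ≤ x) (hxy : x ≤ y) (hy : y ≤ π) :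
    y * cos y * sin x ≤ x * cos x * sin y := by
  have hs : 0 ≤ sin x := sin_nonneg_of_nonneg_of_le_pi hx (hxy.trans hy)
  have hd : 0 ≤ y - x := sub_nonneg.2 hxy
  have h1 : (y - x) * (cos y * sin x) ≤ x * sin (y - x) := by
    rcases le_total (cos y) 0 with h | h
    · exact (mul_nonpos_of_nonneg_of_nonpos hd (mul_nonpos_of_nonpos_of_nonneg h hs)).trans
        (mul_nonneg hx (sin_nonneg_of_nonneg_of_le_pi hd (by linarith)))
    · have h2 : cos y ≤ cos (y - x) := cos_le_cos_of_nonneg_of_le_pi hd hy (by linarith)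
      have h3 : cos y * sin x ≤ cos (y - x) * x :=
        mul_le_mul h2 (sin_le hx) hs (h.trans h2)
      have h4 := mul_le_mul_of_nonneg_left (mul_cos_le_sin hd (by linarith)) hx
      have h5 := mul_le_mul_of_nonneg_left h3 hd
      linarith
  rw [sin_sub] at h1
  linarith

theorem sin_sub_mul_cos_le {x : ℝ} (hx0 : 0 ≤ x) (hx : x ≤ π) (hc : -(3 / 5) ≤ cos x) :
    (sin x - x * cos x) / 2 ≤ (1 - cos x) * sin x := by
  have hs : 0 ≤ sin x := sin_nonneg_of_nonneg_of_le_pi hx0 hx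
  rcases le_total 0 (cos x) with h | h
  · nlinarith [mul_le_mul_of_nonneg_right (sin_le hx0) h,
      mul_nonneg hs (sub_nonneg.2 (cos_le_one x))]
  · have hx2 : π / 2 ≤ x := by
      by_contra! h'
      have := cos_pos_of_mem_Ioo ⟨by linarith [pi_pos], h'⟩
      linarith
    have h1 := mul_le_sin (x := x - π / 2) (by linarith) (by linarith)
    rw [sin_sub_pi_div_two] at h1
    have h2 : 2 / π * (x - π / 2) ≤ 3 / 5 := by linarith
    rw [div_mul_eq_mul_div, div_le_iff₀ pi_pos] at h2
    have h3 : x ≤ 13 / 5 := by linarith [pi_lt_d2]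
    have h4 : 4 / 5 ≤ sin x := by
      nlinarith [sin_sq_add_cos_sq x]
    nlinarith [mul_le_mul_of_nonpos_right h3 h, mul_le_mul_of_nonpos_right h4 h]


/-- The half-period integral of `g` against `κ`, where `2 κ = E'' + E` for some nonnegative
`π`-periodic `E` (written out in the proof), is nonnegative if `g ^ 2` is a positive definite
quadratic form in `(cos, sin)`. -/
theorem integral_mul_sqrt_quadratic_nonneg {a b c : ℝ} (hdet : 0 ≤ a * c - b ^ 2)
    (hpos : ∀ x : ℝ, 0 < a * cos x ^ 2 + 2 * b * (cos x * sin x) + c * sin x ^ 2) :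
    0 ≤ ∫ x in (0:ℝ)..π, (11 / 10 * sin x + x * cos x / 2)
      * √(a * cos x ^ 2 + 2 * b * (cos x * sin x) + c * sin x ^ 2) := by
  set p : ℝ → ℝ := fun x => a * cos x ^ 2 + 2 * b * (cos x * sin x) + c * sin x ^ 2 with hp
  set r : ℝ → ℝ := fun x => (c - a) * (cos x * sin x) + b * (cos x ^ 2 - sin x ^ 2) with hr
  set g : ℝ → ℝ := fun x => √(p x) with hg
  set g' : ℝ → ℝ := fun x => r x / g x with hg'
  set E : ℝ → ℝ := fun x => 17 / 20 * ((π / 2 - x) * cos x + sin x)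
    + (x ^ 2 - π ^ 2 / 2) / 4 * sin x with hE
  set E' : ℝ → ℝ := fun x => - (17 / 20 * ((π / 2 - x) * sin x))
    + (x ^ 2 - π ^ 2 / 2) / 4 * cos x + x / 2 * sin x with hE'
  have hg0 : ∀ x, 0 < g x := fun x => sqrt_pos.2 (hpos x)
  have hgsq : ∀ x, g x ^ 2 = p x := fun x => sq_sqrt (hpos x).le
  have dp : ∀ x, HasDerivAt p (2 * r x) x := fun x => by
    refine (((((hasDerivAt_cos x).pow 2).const_mul a).add
      (((hasDerivAt_cos x).mul (hasDerivAt_sin x)).const_mul (2 * b))).add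
      (((hasDerivAt_sin x).pow 2).const_mul c)).congr_deriv ?_
    simp only [hr]; push_cast; ring
  have dr : ∀ x, HasDerivAt r
      ((c - a) * (cos x ^ 2 - sin x ^ 2) - 4 * b * (cos x * sin x)) x := fun x => by
    refine ((((hasDerivAt_cos x).mul (hasDerivAt_sin x)).const_mul (c - a)).add
      ((((hasDerivAt_cos x).pow 2).sub ((hasDerivAt_sin x).pow 2)).const_mul b)).congr_deriv ?_
    push_cast; ring
  have dg : ∀ x, HasDerivAt g (g' x) x := fun x => by
    refine ((dp x).sqrt (hpos x).ne').congr_deriv ?_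
    simp only [hg', hg]
    field_simp
  have dg' : ∀ x, HasDerivAt g' ((a * c - b ^ 2) / g x ^ 3 - g x) x := fun x => by
    refine ((dr x).div (dg x) (hg0 x).ne').congr_deriv ?_
    have h1 : g' x * g x = r x := div_mul_cancel₀ _ (hg0 x).ne'
    have h2 : p x * ((c - a) * (cos x ^ 2 - sin x ^ 2) - 4 * b * (cos x * sin x)) - r x ^ 2
        + p x ^ 2 = a * c - b ^ 2 := by
      simp only [hp, hr]
      have h4 : sin x ^ 2 = 1 - cos x ^ 2 := sin_sq x
      ring_nf
      simp only [show sin x ^ 4 = sin x ^ 2 * sin x ^ 2 by ring, h4]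
      ring_nf
    have hne := (hg0 x).ne'
    rw [← h2, ← hgsq, ← h1]
    field_simp
    ring
  have dE : ∀ x, HasDerivAt E (E' x) x := fun x => by
    have hs := hasDerivAt_sin x
    have hc := hasDerivAt_cos x
    have hi := hasDerivAt_id x
    refine (((((hi.const_sub (π / 2)).mul hc).add hs).const_mul (17 / 20)).add
      ((((hi.pow 2).sub_const (π ^ 2 / 2)).div_const 4).mul hs)).congr_deriv ?_
    simp only [hE', id, Pi.pow_apply]; push_cast; ring
  have dE' : ∀ x, HasDerivAt E' (2 * (11 / 10 * sin x + x * cos x / 2) - E x) x := fun x => by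
    have hs := hasDerivAt_sin x
    have hc := hasDerivAt_cos x
    have hi := hasDerivAt_id x
    refine ((((((hi.const_sub (π / 2)).mul hs).const_mul (17 / 20)).neg).add
      ((((hi.pow 2).sub_const (π ^ 2 / 2)).div_const 4).mul hc)).add
      ((hi.div_const 2).mul hs)).congr_deriv ?_
    simp only [hE, id, Pi.pow_apply]; push_cast; ring
  have hEnn : ∀ x ∈ Set.Icc 0 π, 0 ≤ E x := by
    intro x hx
    have h1 := sq_mul_cos_le (z := π / 2 - x)
      (by rw [abs_le]; constructor <;> linarith [hx.1, hx.2])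
    rw [cos_pi_div_two_sub, sin_pi_div_two_sub] at h1
    have h2 : 0 ≤ 17 / 20 * (1 + (π / 2 - x) ^ 2) + (x ^ 2 - π ^ 2 / 2) / 4 := by
      nlinarith [sq_nonneg (π / 2 - x - 5 * π / 44), pi_lt_d2, pi_pos]
    have h3 := mul_nonneg h2 (sin_nonneg_of_mem_Icc hx)
    simp only [hE]
    linarith
  have hgc : Continuous g := continuous_iff_continuousAt.2 fun x => (dg x).continuousAt
  have hEc : Continuous E := continuous_iff_continuousAt.2 fun x => (dE x).continuousAt
  have hint : ∫ x in (0:ℝ)..π, (2 * ((11 / 10 * sin x + x * cos x / 2) * g x)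
      - E x * ((a * c - b ^ 2) / g x ^ 3)) = 0 := by
    rw [intervalIntegral.integral_eq_sub_of_hasDerivAt (f := fun x => E' x * g x - E x * g' x)]
    · have h1 : g π = g 0 := by simp [hg, hp]
      have h2 : g' π = g' 0 := by simp [hg', hr, h1]
      have h3 : E π = E 0 := by simp [hE]; ring
      have h4 : E' π = E' 0 := by simp [hE']; ring
      rw [h1, h2, h3, h4, sub_self]
    · intro x _
      refine (((dE' x).mul (dg x)).sub ((dE x).mul (dg' x))).congr_deriv ?_
      ring
    · exact Continuous.intervalIntegrable (by
        have : ∀ x, g x ^ 3 ≠ 0 := fun x => (pow_pos (hg0 x) 3).ne'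
        fun_prop (disch := assumption)) _ _
  have hc2 : Continuous fun x => E x * ((a * c - b ^ 2) / g x ^ 3) := by
    have : ∀ x, g x ^ 3 ≠ 0 := fun x => (pow_pos (hg0 x) 3).ne'
    fun_prop (disch := assumption)
  rw [intervalIntegral.integral_sub (Continuous.intervalIntegrable (by fun_prop) _ _)
    (hc2.intervalIntegrable _ _), intervalIntegral.integral_const_mul] at hint
  have : 0 ≤ ∫ x in (0:ℝ)..π, E x * ((a * c - b ^ 2) / g x ^ 3) :=
    intervalIntegral.integral_nonneg pi_pos.le fun x hx =>
      mul_nonneg (hEnn x hx) (div_nonneg hdet (pow_pos (hg0 x) 3).le)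
  linarith

/-- `integral_mul_sqrt_quadratic_nonneg` for a possibly degenerate norm, by perturbation. -/
theorem integral_mul_norm_nonneg {V : Type*} [NormedAddCommGroup V] [InnerProductSpace ℝ V]
    (v w : V) :
    0 ≤ ∫ x in (0:ℝ)..π, (11 / 10 * sin x + x * cos x / 2) * ‖cos x • v + sin x • w‖ := by
  have key : ∀ δ : ℝ, 0 < δ → -(3 * π * δ) ≤
      ∫ x in (0:ℝ)..π, (11 / 10 * sin x + x * cos x / 2) * ‖cos x • v + sin x • w‖ := by
    intro δ hδ
    have hsq : ∀ x : ℝ, (‖v‖ ^ 2 + δ ^ 2) * cos x ^ 2 + 2 * ⟪v, w⟫_ℝ * (cos x * sin x)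
        + (‖w‖ ^ 2 + δ ^ 2) * sin x ^ 2 = ‖cos x • v + sin x • w‖ ^ 2 + δ ^ 2 := by
      intro x
      rw [norm_add_sq_real, inner_smul_left, inner_smul_right, norm_smul, norm_smul, mul_pow,
        mul_pow, norm_eq_abs, norm_eq_abs, sq_abs, sq_abs]
      simp only [conj_trivial]
      linear_combination δ ^ 2 * sin_sq_add_cos_sq x
    have h := integral_mul_sqrt_quadratic_nonneg (a := ‖v‖ ^ 2 + δ ^ 2) (b := ⟪v, w⟫_ℝ)
      (c := ‖w‖ ^ 2 + δ ^ 2)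
      (by
        have h1 := abs_real_inner_le_norm v w
        have h2 := sq_le_sq' (by linarith [abs_nonneg ⟪v, w⟫_ℝ, neg_abs_le ⟪v, w⟫_ℝ])
          ((le_abs_self _).trans h1)
        nlinarith [mul_nonneg (sq_nonneg ‖v‖) (sq_nonneg δ),
          mul_nonneg (sq_nonneg ‖w‖) (sq_nonneg δ), sq_nonneg (δ ^ 2)])
      (fun x => by rw [hsq]; positivity)
    simp only [hsq] at h
    have hcomp : ∫ x in (0:ℝ)..π, ((11 / 10 * sin x + x * cos x / 2)
        * √(‖cos x • v + sin x • w‖ ^ 2 + δ ^ 2) - 3 * δ) ≤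
        ∫ x in (0:ℝ)..π, (11 / 10 * sin x + x * cos x / 2) * ‖cos x • v + sin x • w‖ := by
      refine intervalIntegral.integral_mono_on pi_pos.le
        (Continuous.intervalIntegrable (by fun_prop) _ _)
        (Continuous.intervalIntegrable (by fun_prop) _ _) fun x hx => ?_
      set N := ‖cos x • v + sin x • w‖ with hN
      have hN0 : 0 ≤ N := norm_nonneg _
      have h1 : N ≤ √(N ^ 2 + δ ^ 2) := le_sqrt_of_sq_le (by nlinarith)
      have h2 : √(N ^ 2 + δ ^ 2) ≤ N + δ := sqrt_le_iff.2 ⟨by positivity, by nlinarith⟩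
      have h3 : 11 / 10 * sin x + x * cos x / 2 ≤ 3 := by
        nlinarith [sin_le_one x, cos_le_one x, hx.1, hx.2, pi_lt_d2]
      nlinarith [mul_nonneg (sub_nonneg.2 h3) (sub_nonneg.2 h1)]
    rw [intervalIntegral.integral_sub (Continuous.intervalIntegrable (by fun_prop) _ _)
      (Continuous.intervalIntegrable (by fun_prop) _ _)] at hcomp
    simp only [intervalIntegral.integral_const, sub_zero, smul_eq_mul] at hcomp
    linarith
  by_contra! hneg
  set I := ∫ x in (0:ℝ)..π, (11 / 10 * sin x + x * cos x / 2) * ‖cos x • v + sin x • w‖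
  have := key (-I / (6 * π)) (div_pos (by linarith) (by positivity))
  have e : 3 * π * (-I / (6 * π)) = -I / 2 := by field_simp; ring
  linarith

/-- With `f = sin * G`, where `G` is the norm of a solution of `z'' + z = 0`, one has
`sin * f ≤ (1 - cos) f` on `[0, π]`. -/
theorem integral_sin_sub_mul_cos_le {V : Type*} [NormedAddCommGroup V] [InnerProductSpace ℝ V]
    (a b : V) {t : ℝ} (ht0 : 0 ≤ t) (ht : t ≤ π) :
    ∫ s in (0:ℝ)..t, (sin (t - s) - (t - s) * cos (t - s)) / 2 * ‖cos s • a + sin s • b‖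
      ≤ (1 - cos t) * ∫ s in (0:ℝ)..t, sin (t - s) * ‖cos s • a + sin s • b‖ := by
  rw [← intervalIntegral.integral_const_mul]
  by_cases hct : -(3 / 5) ≤ cos t
  · refine intervalIntegral.integral_mono_on ht0 (Continuous.intervalIntegrable (by fun_prop) _ _)
      (Continuous.intervalIntegrable (by fun_prop) _ _) fun s hs => ?_
    rw [← mul_assoc]
    refine mul_le_mul_of_nonneg_right ?_ (norm_nonneg _)
    have h1 : cos t ≤ cos (t - s) :=
      cos_le_cos_of_nonneg_of_le_pi (by linarith [hs.2]) ht (by linarith [hs.1])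
    have h2 : 0 ≤ sin (t - s) :=
      sin_nonneg_of_nonneg_of_le_pi (by linarith [hs.2]) (by linarith [hs.1])
    refine (sin_sub_mul_cos_le (by linarith [hs.2]) (by linarith [hs.1]) (hct.trans h1)).trans ?_
    exact mul_le_mul_of_nonneg_right (by linarith) h2
  push Not at hct
  set v := cos t • a + sin t • b with hv
  set w := sin t • a - cos t • b with hw
  have hG : ∀ s, ‖cos s • a + sin s • b‖ = ‖cos (t - s) • v + sin (t - s) • w‖ := by
    intro s
    congr 1
    rw [cos_sub, sin_sub, hv, hw]
    have h := sin_sq_add_cos_sq t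
    match_scalars
    · linear_combination (- cos s) * h
    · linear_combination (- sin s) * h
  simp only [hG]
  rw [intervalIntegral.integral_comp_sub_left
      (fun x => (sin x - x * cos x) / 2 * ‖cos x • v + sin x • w‖) t,
    intervalIntegral.integral_comp_sub_left
      (fun x => (1 - cos t) * (sin x * ‖cos x • v + sin x • w‖)) t]
  simp only [sub_self, sub_zero]
  set N : ℝ → ℝ := fun x => ‖cos x • v + sin x • w‖ with hN
  have hNc : Continuous N := by fun_prop
  have hN0 : ∀ x, 0 ≤ N x := fun x => norm_nonneg _
  set κ : ℝ → ℝ := fun x => 11 / 10 * sin x + x * cos x / 2 with hκ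
  have hκc : Continuous κ := by fun_prop
  have hκmono : ∀ x y, 0 ≤ x → x ≤ y → y ≤ π → κ y * sin x ≤ κ x * sin y := by
    intro x y hx hxy hy
    have := mul_cos_mul_sin_le hx hxy hy
    simp only [hκ]
    linarith
  have hmain : 0 ≤ ∫ x in (0:ℝ)..t, κ x * N x := by
    have hπ : 0 ≤ ∫ x in (0:ℝ)..π, κ x * N x := integral_mul_norm_nonneg v w
    rcases ht.eq_or_lt with rfl | htπ
    · exact hπ
    have ht0' : 0 < t := ht0.lt_of_ne (by rintro rfl; norm_num at hct)
    have hst : 0 < sin t := sin_pos_of_pos_of_lt_pi ht0' htπ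
    rcases le_total 0 (κ t) with h | h
    · refine intervalIntegral.integral_nonneg ht0 fun x hx => mul_nonneg ?_ (hN0 x)
      refine nonneg_of_mul_nonneg_left ((mul_nonneg h ?_).trans (hκmono x t hx.1 hx.2 ht)) hst
      exact sin_nonneg_of_nonneg_of_le_pi hx.1 (hx.2.trans ht)
    · have htail : 0 ≤ ∫ x in t..π, -(κ x * N x) := by
        refine intervalIntegral.integral_nonneg ht fun x hx => ?_
        have h1 : κ x * sin t ≤ 0 := (hκmono t x ht0 hx.1 hx.2).trans
          (mul_nonpos_of_nonpos_of_nonneg h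
            (sin_nonneg_of_nonneg_of_le_pi (ht0.trans hx.1) hx.2))
        have h2 : κ x ≤ 0 := nonpos_of_mul_nonpos_left h1 hst
        exact neg_nonneg.2 (mul_nonpos_of_nonpos_of_nonneg h2 (hN0 x))
      rw [intervalIntegral.integral_neg] at htail
      have := intervalIntegral.integral_add_adjacent_intervals (μ := MeasureTheory.volume)
        ((hκc.mul hNc).intervalIntegrable 0 t) ((hκc.mul hNc).intervalIntegrable t π)
      simp only [Pi.mul_apply] at this
      linarith
  rw [← sub_nonneg, ← intervalIntegral.integral_sub
    (Continuous.intervalIntegrable (by fun_prop) _ _)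
    (Continuous.intervalIntegrable (by fun_prop) _ _)]
  refine hmain.trans (intervalIntegral.integral_mono_on ht0
    (Continuous.intervalIntegrable (by fun_prop) _ _)
    (Continuous.intervalIntegrable (by fun_prop) _ _) fun x hx => ?_)
  have h1 := mul_nonneg (mul_nonneg (by linarith : 0 ≤ -(3 / 5) - cos t)
    (sin_nonneg_of_nonneg_of_le_pi hx.1 (hx.2.trans ht))) (hN0 x)
  simp only [hκ]
  change _ ≤ (1 - cos t) * (sin x * N x) - (sin x - x * cos x) / 2 * N x
  linarith

/-- Variation of parameters for `z'' + z = φ` with vanishing initial data. -/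
theorem eq_integral_sin_smul {E : Type*} [NormedAddCommGroup E] [NormedSpace ℝ E]
    [CompleteSpace E] {z z' z'' φ : ℝ → E} {T : ℝ} (hT : 0 ≤ T)
    (hz : ∀ s, HasDerivAt z (z' s) s) (hz' : ∀ s, HasDerivAt z' (z'' s) s)
    (h0 : z 0 = 0) (h0' : z' 0 = 0) (hφ : Continuous φ)
    (hode : ∀ s ∈ Set.Icc 0 T, z'' s + z s = φ s) :
    z T = ∫ s in (0:ℝ)..T, sin (T - s) • φ s := by
  have hd : ∀ s ∈ Set.uIcc 0 T,
      HasDerivAt (fun s => sin (T - s) • z' s + cos (T - s) • z s) (sin (T - s) • φ s) s := by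
    intro s hs
    rw [Set.uIcc_of_le hT] at hs
    have hsub : HasDerivAt (fun s : ℝ => T - s) (-1) s := by
      simpa using (hasDerivAt_id s).const_sub T
    refine ((hsub.sin.smul (hz' s)).add (hsub.cos.smul (hz s))).congr_deriv ?_
    rw [← hode s hs]
    module
  rw [intervalIntegral.integral_eq_sub_of_hasDerivAt hd
    (Continuous.intervalIntegrable (by fun_prop) _ _)]
  simp [h0, h0']

theorem integral_sin_sub (t : ℝ) : ∫ s in (0:ℝ)..t, sin (t - s) = 1 - cos t := by
  rw [intervalIntegral.integral_comp_sub_left (fun x => sin x) t]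
  simp

theorem sin_sub_nonneg {s t : ℝ} (hs : s ∈ Set.Icc 0 t) (ht : t ≤ π) : 0 ≤ sin (t - s) :=
  sin_nonneg_of_nonneg_of_le_pi (by linarith [hs.2]) (by linarith [hs.1])

/-- The operator `f ↦ ∫₀ᵗ sin (t - s) f s` is monotone on `[0, π]`. -/
theorem integral_sin_mul_mono {f g : ℝ → ℝ} (hf : Continuous f) (hg : Continuous g) {t : ℝ}
    (ht0 : 0 ≤ t) (ht : t ≤ π) (hfg : ∀ s ∈ Set.Icc 0 t, f s ≤ g s) :
    ∫ s in (0:ℝ)..t, sin (t - s) * f s ≤ ∫ s in (0:ℝ)..t, sin (t - s) * g s := by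
  refine intervalIntegral.integral_mono_on ht0 (Continuous.intervalIntegrable (by fun_prop) _ _)
    (Continuous.intervalIntegrable (by fun_prop) _ _) fun s hs => ?_
  exact mul_le_mul_of_nonneg_left (hfg s hs) (sin_sub_nonneg hs ht)

theorem hasDerivAt_integral_of_continuous {f : ℝ → ℝ} (hf : Continuous f) (t : ℝ) :
    HasDerivAt (fun t => ∫ s in (0:ℝ)..t, f s) (f t) t :=
  intervalIntegral.integral_hasDerivAt_right (hf.intervalIntegrable _ _)
    (hf.stronglyMeasurableAtFilter _ _) hf.continuousAt

theorem integral_sin_mul_eq {G : ℝ → ℝ} (hG : Continuous G) (t : ℝ) :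
    ∫ s in (0:ℝ)..t, sin (t - s) * G s
      = sin t * (∫ s in (0:ℝ)..t, cos s * G s) - cos t * (∫ s in (0:ℝ)..t, sin s * G s) := by
  rw [← intervalIntegral.integral_const_mul, ← intervalIntegral.integral_const_mul,
    ← intervalIntegral.integral_sub (Continuous.intervalIntegrable (by fun_prop) _ _)
      (Continuous.intervalIntegrable (by fun_prop) _ _)]
  congr 1; ext s; rw [sin_sub]; ring

theorem integral_mul_sin_mul_eq {G : ℝ → ℝ} (hG : Continuous G) (t : ℝ) :
    ∫ s in (0:ℝ)..t, (t - s) * sin (t - s) * G s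
      = t * (sin t * (∫ s in (0:ℝ)..t, cos s * G s) - cos t * (∫ s in (0:ℝ)..t, sin s * G s))
        - (sin t * (∫ s in (0:ℝ)..t, s * cos s * G s)
          - cos t * (∫ s in (0:ℝ)..t, s * sin s * G s)) := by
  simp only [← intervalIntegral.integral_const_mul]
  repeat rw [← intervalIntegral.integral_sub (Continuous.intervalIntegrable (by fun_prop) _ _)
      (Continuous.intervalIntegrable (by fun_prop) _ _)]
  rw [← intervalIntegral.integral_const_mul]
  rw [← intervalIntegral.integral_sub (Continuous.intervalIntegrable (by fun_prop) _ _)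
      (Continuous.intervalIntegrable (by fun_prop) _ _)]
  congr 1; ext s; rw [sin_sub]; ring

theorem integral_mul_cos_mul_eq {G : ℝ → ℝ} (hG : Continuous G) (t : ℝ) :
    ∫ s in (0:ℝ)..t, (t - s) * cos (t - s) * G s
      = t * (cos t * (∫ s in (0:ℝ)..t, cos s * G s) + sin t * (∫ s in (0:ℝ)..t, sin s * G s))
        - (cos t * (∫ s in (0:ℝ)..t, s * cos s * G s)
          + sin t * (∫ s in (0:ℝ)..t, s * sin s * G s)) := by
  simp only [← intervalIntegral.integral_const_mul]
  repeat rw [← intervalIntegral.integral_add (Continuous.intervalIntegrable (by fun_prop) _ _)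
      (Continuous.intervalIntegrable (by fun_prop) _ _)]
  rw [← intervalIntegral.integral_const_mul]
  rw [← intervalIntegral.integral_sub (Continuous.intervalIntegrable (by fun_prop) _ _)
      (Continuous.intervalIntegrable (by fun_prop) _ _)]
  congr 1; ext s; rw [cos_sub]; ring

/-- First and second derivative of the twofold convolution of `sin` with `G`. -/
theorem hasDerivAt_integral_sin_sub_mul_cos {G : ℝ → ℝ} (hG : Continuous G) (t : ℝ) :
    HasDerivAt (fun t => ∫ s in (0:ℝ)..t, (sin (t - s) - (t - s) * cos (t - s)) / 2 * G s)
      (∫ s in (0:ℝ)..t, (t - s) * sin (t - s) * G s / 2) t ∧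
    HasDerivAt (fun t => ∫ s in (0:ℝ)..t, (t - s) * sin (t - s) * G s / 2)
      ((∫ s in (0:ℝ)..t, sin (t - s) * G s)
        - ∫ s in (0:ℝ)..t, (sin (t - s) - (t - s) * cos (t - s)) / 2 * G s) t := by
  have e : ∀ t, ∫ s in (0:ℝ)..t, (sin (t - s) - (t - s) * cos (t - s)) / 2 * G s
      = ((∫ s in (0:ℝ)..t, sin (t - s) * G s)
        - ∫ s in (0:ℝ)..t, (t - s) * cos (t - s) * G s) / 2 := by
    intro t
    rw [← intervalIntegral.integral_sub (Continuous.intervalIntegrable (by fun_prop) _ _)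
      (Continuous.intervalIntegrable (by fun_prop) _ _), ← intervalIntegral.integral_div]
    congr 1; ext s; ring
  simp only [e, intervalIntegral.integral_div, integral_sin_mul_eq hG,
    integral_mul_sin_mul_eq hG, integral_mul_cos_mul_eq hG]
  have d1 := hasDerivAt_integral_of_continuous (f := fun s => cos s * G s) (by fun_prop) t
  have d2 := hasDerivAt_integral_of_continuous (f := fun s => sin s * G s) (by fun_prop) t
  have d3 := hasDerivAt_integral_of_continuous (f := fun s => s * cos s * G s) (by fun_prop) t
  have d4 := hasDerivAt_integral_of_continuous (f := fun s => s * sin s * G s) (by fun_prop) t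
  have ds := hasDerivAt_sin t
  have dc := hasDerivAt_cos t
  have di := hasDerivAt_id t
  constructor
  · refine ((((ds.mul d1).sub (dc.mul d2)).sub
      ((di.mul ((dc.mul d1).add (ds.mul d2))).sub ((dc.mul d3).add (ds.mul d4)))).div_const 2
      ).congr_deriv ?_
    simp only [id, Pi.mul_apply, Pi.add_apply]
    ring
  · refine (((di.mul ((ds.mul d1).sub (dc.mul d2))).sub
      ((ds.mul d3).sub (dc.mul d4))).div_const 2).congr_deriv ?_
    simp only [id, Pi.mul_apply, Pi.sub_apply]
    ring

theorem integral_sin_mul_integral_sin_mul {G : ℝ → ℝ} (hG : Continuous G) {t : ℝ} (ht : 0 ≤ t) :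
    ∫ r in (0:ℝ)..t, sin (t - r) * (∫ s in (0:ℝ)..r, sin (r - s) * G s)
      = ∫ s in (0:ℝ)..t, (sin (t - s) - (t - s) * cos (t - s)) / 2 * G s := by
  have hc : Continuous fun r => ∫ s in (0:ℝ)..r, sin (r - s) * G s := by
    fun_prop
  symm
  exact eq_integral_sin_smul ht (fun s => (hasDerivAt_integral_sin_sub_mul_cos hG s).1)
    (fun s => (hasDerivAt_integral_sin_sub_mul_cos hG s).2) (by simp) (by simp) hc
    (fun s _ => by ring)

theorem integral_sin_sub_mul_cos_mono {G : ℝ → ℝ} (hG : Continuous G) (hG0 : ∀ s, 0 ≤ G s) :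
    MonotoneOn (fun t => ∫ s in (0:ℝ)..t, (sin (t - s) - (t - s) * cos (t - s)) / 2 * G s)
      (Set.Icc 0 π) := by
  refine monotoneOn_of_hasDerivWithinAt_nonneg (convex_Icc _ _)
    (fun t _ => (hasDerivAt_integral_sin_sub_mul_cos hG t).1.continuousAt.continuousWithinAt)
    (fun t _ => (hasDerivAt_integral_sin_sub_mul_cos hG t).1.hasDerivWithinAt) fun t ht => ?_
  rw [interior_Icc] at ht
  refine intervalIntegral.integral_nonneg ht.1.le fun s hs => ?_
  have := sin_sub_nonneg hs ht.2.le
  have := hG0 s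
  have : 0 ≤ t - s := by linarith [hs.2]
  positivity

/-- A Grönwall-type bound for the kernel `sin (t - s)` and a nondecreasing forcing term. -/
theorem le_div_of_le_add_integral_sin {p h : ℝ → ℝ} {θ t : ℝ} (hp : Continuous p)
    (hp0 : ∀ s ∈ Set.Icc 0 t, 0 ≤ p s) (hh : MonotoneOn h (Set.Icc 0 π)) (hθ : 0 ≤ θ)
    (ht0 : 0 ≤ t) (ht : t ≤ π) (hθt : 0 < 1 - θ * (1 - cos t))
    (hle : ∀ s ∈ Set.Icc 0 t, p s ≤ h s + θ * ∫ r in (0:ℝ)..s, sin (s - r) * p r) :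
    p t ≤ h t / (1 - θ * (1 - cos t)) := by
  obtain ⟨s, hs, hmax⟩ := isCompact_Icc.exists_isMaxOn (Set.nonempty_Icc.2 ht0) hp.continuousOn
  have h1 : ∫ r in (0:ℝ)..s, sin (s - r) * p r ≤ (1 - cos s) * p s := by
    rw [← integral_sin_sub, ← intervalIntegral.integral_mul_const]
    exact integral_sin_mul_mono hp continuous_const hs.1 (hs.2.trans ht)
      fun r hr => hmax ⟨hr.1, hr.2.trans hs.2⟩
  have h2 : h s ≤ h t := hh ⟨hs.1, hs.2.trans ht⟩ ⟨ht0, ht⟩ hs.2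
  have h3 : cos t ≤ cos s := cos_le_cos_of_nonneg_of_le_pi hs.1 ht hs.2
  have h4 := mul_le_mul_of_nonneg_left h1 hθ
  have h5 := mul_nonneg (mul_nonneg hθ (hp0 s hs)) (sub_nonneg.2 h3)
  have h6 : p s ≤ h t / (1 - θ * (1 - cos t)) := by
    rw [le_div_iff₀ hθt]
    linarith [hle s hs]
  exact (hmax ⟨ht0, le_rfl⟩).trans h6

/-- If the convolution `f = sin * G` satisfies `sin * f ≤ (1 - cos) f`, then `w ≤ θ (f + sin * w)`
implies `w ≤ θ f / (1 - θ (1 - cos))`. -/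
theorem le_of_le_integral_sin_mul_add {w G : ℝ → ℝ} {θ t : ℝ} (hw : Continuous w)
    (hG : Continuous G) (hw0 : ∀ s, 0 ≤ w s) (hG0 : ∀ s, 0 ≤ G s) (hθ : 0 ≤ θ) (ht0 : 0 ≤ t)
    (ht : t ≤ π) (hθt : 0 < 1 - θ * (1 - cos t))
    (hle : ∀ s ∈ Set.Icc 0 t, w s ≤ θ * ∫ r in (0:ℝ)..s, sin (s - r) * (G r + w r))
    (hconv : ∫ s in (0:ℝ)..t, (sin (t - s) - (t - s) * cos (t - s)) / 2 * G s
      ≤ (1 - cos t) * ∫ s in (0:ℝ)..t, sin (t - s) * G s) :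
    w t ≤ θ / (1 - θ * (1 - cos t)) * ∫ s in (0:ℝ)..t, sin (t - s) * G s := by
  set f : ℝ → ℝ := fun t => ∫ s in (0:ℝ)..t, sin (t - s) * G s with hf
  set p : ℝ → ℝ := fun t => ∫ s in (0:ℝ)..t, sin (t - s) * w s with hp
  set h : ℝ → ℝ := fun t => ∫ s in (0:ℝ)..t, (sin (t - s) - (t - s) * cos (t - s)) / 2 * G s
    with hh
  have hfc : Continuous f := by fun_prop
  have hpc : Continuous p := by fun_prop
  have hle' : ∀ s ∈ Set.Icc 0 t, w s ≤ θ * f s + θ * p s := fun s hs => by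
    refine (hle s hs).trans_eq ?_
    rw [← mul_add, hf, hp]
    dsimp only
    rw [← intervalIntegral.integral_add (Continuous.intervalIntegrable (by fun_prop) _ _)
      (Continuous.intervalIntegrable (by fun_prop) _ _)]
    simp only [mul_add]
  have hp0 : ∀ s ∈ Set.Icc 0 t, 0 ≤ p s := fun s hs =>
    intervalIntegral.integral_nonneg hs.1 fun r hr =>
      mul_nonneg (sin_sub_nonneg hr (hs.2.trans ht)) (hw0 r)
  have hple : ∀ s ∈ Set.Icc 0 t, p s ≤ θ * h s + θ * ∫ r in (0:ℝ)..s, sin (s - r) * p r := by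
    intro s hs
    refine (integral_sin_mul_mono hw (g := fun r => θ * f r + θ * p r) (by fun_prop) hs.1
      (hs.2.trans ht) fun r hr => hle' r ⟨hr.1, hr.2.trans hs.2⟩).trans_eq ?_
    rw [hh]
    dsimp only
    rw [← integral_sin_mul_integral_sin_mul hG hs.1, ← intervalIntegral.integral_const_mul,
      ← intervalIntegral.integral_const_mul,
      ← intervalIntegral.integral_add (Continuous.intervalIntegrable (by fun_prop) _ _)
      (Continuous.intervalIntegrable (by fun_prop) _ _)]
    congr 1; ext r; ring
  have hpt := le_div_of_le_add_integral_sin hpc hp0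
    (fun a ha b hb hab => mul_le_mul_of_nonneg_left (integral_sin_sub_mul_cos_mono hG hG0 ha hb hab)
      hθ) hθ ht0 ht hθt hple
  have hwt := hle' t ⟨ht0, le_rfl⟩
  rw [le_div_iff₀ hθt] at hpt
  rw [div_mul_eq_mul_div, le_div_iff₀ hθt]
  change _ ≤ (1 - cos t) * f t at hconv
  have e1 := mul_le_mul_of_nonneg_left hpt hθ
  have e2 := mul_le_mul_of_nonneg_left hconv (mul_nonneg hθ hθ)
  have e3 := mul_le_mul_of_nonneg_right hwt hθt.le
  change _ ≤ θ * f t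
  linarith

/-- Bound on the deviation `u = y - ȳ` of a solution of the Jacobi ODE `y'' + R(t) y = 0`
with `‖R(t) - k·id‖ ≤ ε₁ < k/2` from the comparison solution
`ȳ(t) = cos(√k t)·y(0) + (sin(√k t)/√k)·y'(0)`. -/
theorem stmt_2 {n : ℕ} (k ε₁ : ℝ) (hk : 0 < k) (hε₁ : 0 ≤ ε₁) (hε₁k : ε₁ < k / 2)
    (R : ℝ → EuclideanSpace ℝ (Fin n) →L[ℝ] EuclideanSpace ℝ (Fin n))
    (hRcont : Continuous R)
    (hR : ∀ t ∈ Set.Icc (0 : ℝ) (π / Real.sqrt k),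
      ‖R t - k • ContinuousLinearMap.id ℝ (EuclideanSpace ℝ (Fin n))‖ ≤ ε₁)
    (y y' y'' : ℝ → EuclideanSpace ℝ (Fin n))
    (hy : ∀ t, HasDerivAt y (y' t) t) (hy' : ∀ t, HasDerivAt y' (y'' t) t)
    (hode : ∀ t ∈ Set.Icc (0 : ℝ) (π / Real.sqrt k), y'' t + R t (y t) = 0)
    (ybar u : ℝ → EuclideanSpace ℝ (Fin n))
    (hybar : ∀ t, ybar t = Real.cos (Real.sqrt k * t) • y 0
      + (Real.sin (Real.sqrt k * t) / Real.sqrt k) • y' 0)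
    (hu : ∀ t, u t = y t - ybar t) :
    ∀ t ∈ Set.Icc (0 : ℝ) (π / Real.sqrt k),
      ‖u t‖ ≤ ε₁ / (k - (1 - Real.cos (Real.sqrt k * t)) * ε₁)
        * ∫ s in (0:ℝ)..t, Real.sqrt k * ‖ybar s‖ * Real.sin (Real.sqrt k * (t - s)) := by
  intro t ht
  set ω := √k with hω
  have hω0 : 0 < ω := sqrt_pos.2 hk
  have hω2 : ω ^ 2 = k := sq_sqrt hk.le
  have hωne := hω0.ne'
  have hscale : ∀ τ ∈ Set.Icc 0 π, τ / ω ∈ Set.Icc 0 (π / ω) := fun τ hτ =>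
    ⟨div_nonneg hτ.1 hω0.le, div_le_div_of_nonneg_right hτ.2 hω0.le⟩
  have hyc : Continuous y := continuous_iff_continuousAt.2 fun s => (hy s).continuousAt
  set w : EuclideanSpace ℝ (Fin n) := (1 / ω) • y' 0 with hw
  have hybar' : ∀ τ, ybar (τ / ω) = cos τ • y 0 + sin τ • w := fun τ => by
    rw [hybar, mul_div_cancel₀ _ hωne, hw, smul_smul, mul_one_div]
  set z : ℝ → EuclideanSpace ℝ (Fin n) := fun τ => y (τ / ω) - (cos τ • y 0 + sin τ • w) with hz
  have huz : ∀ τ, u (τ / ω) = z τ := fun τ => by rw [hu, hybar']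
  have hdiv : ∀ τ : ℝ, HasDerivAt (fun τ => τ / ω) (1 / ω) τ := fun τ =>
    (hasDerivAt_id τ).div_const ω
  have dz : ∀ τ, HasDerivAt z ((1 / ω) • y' (τ / ω) - (-sin τ • y 0 + cos τ • w)) τ := fun τ =>
    ((hy (τ / ω)).scomp τ (hdiv τ)).sub
      (((hasDerivAt_cos τ).smul_const (y 0)).add ((hasDerivAt_sin τ).smul_const w))
  have dz' : ∀ τ, HasDerivAt (fun τ => (1 / ω) • y' (τ / ω) - (-sin τ • y 0 + cos τ • w))
      ((1 / ω) • (1 / ω) • y'' (τ / ω) - (-cos τ • y 0 + -sin τ • w)) τ := fun τ =>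
    (((hy' (τ / ω)).scomp τ (hdiv τ)).const_smul (1 / ω)).sub
      (((hasDerivAt_sin τ).neg.smul_const (y 0)).add ((hasDerivAt_cos τ).smul_const w))
  set φ : ℝ → EuclideanSpace ℝ (Fin n) := fun τ =>
    -((1 / k) • (R (τ / ω) - k • ContinuousLinearMap.id ℝ (EuclideanSpace ℝ (Fin n)))
      (y (τ / ω))) with hφ
  have hφc : Continuous φ := by fun_prop
  have hzφ : ∀ τ ∈ Set.Icc 0 π,
      (1 / ω) • (1 / ω) • y'' (τ / ω) - (-cos τ • y 0 + -sin τ • w) + z τ = φ τ := by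
    intro τ hτ
    have h := eq_neg_of_add_eq_zero_left (hode _ (hscale τ hτ))
    have hk' : (1 / ω) * (1 / ω) = 1 / k := by rw [← hω2]; field_simp
    simp only [hz, hφ, smul_smul, hk', h, sub_apply,
      smul_apply, ContinuousLinearMap.id_apply, smul_sub]
    rw [one_div_mul_cancel hk.ne']
    module
  set G : ℝ → ℝ := fun τ => ‖cos τ • y 0 + sin τ • w‖ with hG
  have hGc : Continuous G := by fun_prop
  have hzc : Continuous z := by fun_prop
  have hφle : ∀ τ ∈ Set.Icc 0 π, ‖φ τ‖ ≤ ε₁ / k * (G τ + ‖z τ‖) := by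
    intro τ hτ
    have h1 : ‖y (τ / ω)‖ ≤ G τ + ‖z τ‖ := by
      refine (le_of_eq ?_).trans (norm_add_le (cos τ • y 0 + sin τ • w) (z τ))
      simp only [hz, add_sub_cancel]
    have h2 := ((R (τ / ω) - k • ContinuousLinearMap.id ℝ (EuclideanSpace ℝ (Fin n))).le_opNorm
      (y (τ / ω))).trans
      (mul_le_mul (hR _ (hscale τ hτ)) h1 (norm_nonneg _) hε₁)
    rw [hφ, norm_neg, norm_smul, norm_of_nonneg (by positivity : 0 ≤ 1 / k)]
    refine (mul_le_mul_of_nonneg_left h2 (by positivity)).trans_eq ?_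
    ring
  set T := ω * t with hT
  have htT : t = T / ω := by rw [hT, mul_div_cancel_left₀ _ hωne]
  have hT0 : 0 ≤ T := mul_nonneg hω0.le ht.1
  have hTπ : T ≤ π := by rw [hT, mul_comm]; exact (le_div_iff₀ hω0).1 ht.2
  have hle : ∀ s ∈ Set.Icc 0 T,
      ‖z s‖ ≤ ε₁ / k * ∫ r in (0:ℝ)..s, sin (s - r) * (G r + ‖z r‖) := by
    intro s hs
    have hsπ := hs.2.trans hTπ
    rw [eq_integral_sin_smul hs.1 dz dz' (by simp [hz]) (by simp [hw]) hφc
      fun r hr => hzφ r ⟨hr.1, hr.2.trans hsπ⟩, ← intervalIntegral.integral_const_mul]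
    refine intervalIntegral.norm_integral_le_of_norm_le hs.1 (.of_forall fun r hr => ?_)
      (Continuous.intervalIntegrable (by fun_prop) _ _)
    have hr' := Set.Ioc_subset_Icc_self hr
    have h1 := sin_sub_nonneg hr' hsπ
    rw [norm_smul, norm_of_nonneg h1]
    refine (mul_le_mul_of_nonneg_left (hφle r ⟨hr'.1, hr'.2.trans hsπ⟩) h1).trans_eq ?_
    ring
  have hden : 0 < k - (1 - cos T) * ε₁ := by
    nlinarith [mul_nonneg (by linarith [neg_one_le_cos T] : 0 ≤ 1 + cos T) hε₁]
  have hfac : 1 - ε₁ / k * (1 - cos T) = (k - (1 - cos T) * ε₁) / k := by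
    field_simp
  have hbound := le_of_le_integral_sin_mul_add hzc.norm hGc (fun _ => norm_nonneg _)
    (fun _ => norm_nonneg _) (by positivity) hT0 hTπ (by rw [hfac]; positivity) hle
    (integral_sin_sub_mul_cos_le (y 0) w hT0 hTπ)
  rw [hfac, div_div_div_cancel_right₀ hk.ne', ← huz, ← htT] at hbound
  refine hbound.trans_eq ?_
  congr 1
  have hcv := intervalIntegral.mul_integral_comp_mul_left (a := 0) (b := t)
    (f := fun σ => sin (T - σ) * G σ) ω
  rw [mul_zero, ← hT] at hcv
  rw [← hcv, ← intervalIntegral.integral_const_mul]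
  congr 1
  ext s
  have hs : ybar s = cos (ω * s) • y 0 + sin (ω * s) • w := by
    rw [← hybar', mul_div_cancel_left₀ _ hωne]
  rw [hs, mul_sub]
  ring
end

section
/- Let k > 0, let g : ℝ → ℝ be continuous with g(t)² ≤ c for all t ≥ 0 for some constant c < k, and let B : ℝ → (ℝⁿ →L[ℝ] ℝⁿ) be differentiable and satisfy the weighted matrix Riccati equation B'(t) + B(t)² + 2g(t)·B(t) + k·id = 0 for all t ∈ [0, ∞). Then B(0) has no real eigenvalue; in particular, if n is odd, then no such B exists on [0, ∞). -/
open Real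

/-- A real polynomial of odd degree with positive leading coefficient has a real root. -/
theorem exists_isRoot_of_odd_natDegree_of_leadingCoeff_pos (p : Polynomial ℝ)
    (hodd : Odd p.natDegree) (hlead : 0 < p.leadingCoeff) : ∃ x, p.IsRoot x := by
  have hdeg : 0 < p.natDegree := hodd.pos
  have htop : Filter.Tendsto (fun x => p.eval x) Filter.atTop Filter.atTop :=
    p.tendsto_atTop_of_leadingCoeff_nonneg (Polynomial.natDegree_pos_iff_degree_pos.1 hdeg)
      hlead.le
  have hbot : Filter.Tendsto (fun x => (p.comp (-Polynomial.X)).eval x)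
      Filter.atTop Filter.atBot := by
    have hnat : (p.comp (-Polynomial.X)).natDegree = p.natDegree := by
      simp [Polynomial.natDegree_comp]
    refine Polynomial.tendsto_atBot_of_leadingCoeff_nonpos _
      (Polynomial.natDegree_pos_iff_degree_pos.1 (hnat ▸ hdeg)) ?_
    rw [Polynomial.leadingCoeff_comp (by simp)]
    simpa [hodd.neg_one_pow] using hlead.le
  obtain ⟨a, ha⟩ := (htop.eventually_ge_atTop 0).exists
  obtain ⟨b, hb⟩ := (hbot.eventually_le_atBot 0).exists
  simp only [Polynomial.eval_comp, Polynomial.eval_neg, Polynomial.eval_X] at hb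
  exact mem_range_of_exists_le_of_exists_ge p.continuous ⟨-b, hb⟩ ⟨a, ha⟩

/-- An endomorphism of an odd-dimensional real vector space has a real eigenvalue. -/
theorem LinearMap.exists_hasEigenvalue_of_odd_finrank {E : Type*} [AddCommGroup E] [Module ℝ E]
    [FiniteDimensional ℝ E] (f : E →ₗ[ℝ] E) (hE : Odd (Module.finrank ℝ E)) :
    ∃ lam : ℝ, Module.End.HasEigenvalue f lam := by
  obtain ⟨x, hx⟩ := exists_isRoot_of_odd_natDegree_of_leadingCoeff_pos f.charpoly
    (by rwa [f.charpoly_natDegree]) (by rw [f.charpoly_monic.leadingCoeff]; exact one_pos)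
  exact ⟨x, (Module.End.hasEigenvalue_iff_isRoot_charpoly f x).2 hx⟩

/-- A scalar function cannot satisfy `u' = -(u² + 2gu + k)` on all of `[0, ∞)` when
`g² ≤ c < k`. -/
theorem false_of_hasDerivAt_scalar_riccati {k c : ℝ} (hk : 0 < k) (hc : c < k) {g u : ℝ → ℝ}
    (hg : ∀ t, 0 ≤ t → g t ^ 2 ≤ c)
    (hu : ∀ t, 0 ≤ t → HasDerivAt u (-(u t ^ 2 + 2 * g t * u t + k)) t) : False := by
  have hc0 : 0 ≤ c := (sq_nonneg (g 0)).trans (hg 0 le_rfl)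
  obtain ⟨m, hm, hbound⟩ : ∃ m > 0, ∀ a x : ℝ, a ^ 2 ≤ c →
      m * (1 + x ^ 2) ≤ x ^ 2 + 2 * a * x + k := by
    -- The discriminant condition `c ≤ (1 - m) (k - m)` holds for this `m`.
    have hpos : 0 < 1 + k := by linarith
    refine ⟨(k - c) / (1 + k), div_pos (by linarith) hpos, fun a x ha => ?_⟩
    set m := (k - c) / (1 + k) with hmdef
    have hmk : m * (1 + k) = k - c := div_mul_cancel₀ _ hpos.ne'
    have hm1 : 0 < 1 - m := by
      rw [hmdef, sub_pos, div_lt_one hpos]; linarith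
    have hfac : 0 ≤ (1 - m) * (x ^ 2 + 2 * a * x + k - m * (1 + x ^ 2)) := by
      nlinarith [sq_nonneg ((1 - m) * x + a), sq_nonneg m]
    have := nonneg_of_mul_nonneg_right hfac hm1
    linarith
  have hderiv : ∀ t, 0 ≤ t → HasDerivAt (fun s => arctan (u s))
      (1 / (1 + u t ^ 2) * (-(u t ^ 2 + 2 * g t * u t + k))) t :=
    fun t ht => (hu t ht).arctan
  have hT : 0 ≤ π / m := by positivity
  have hle := image_le_of_deriv_right_le_deriv_boundary (a := 0) (b := π / m)
    (fun t ht => (hderiv t ht.1).continuousAt.continuousWithinAt)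
    (fun t ht => (hderiv t ht.1).hasDerivWithinAt)
    (B := fun t => arctan (u 0) + -m * t) (B' := fun _ => -m) (by simp) (by fun_prop)
    (fun t _ => by
      simpa using (((hasDerivAt_id t).const_mul (-m)).const_add (arctan (u 0))).hasDerivWithinAt)
    (fun t ht => by
      have hpos : 0 < 1 + u t ^ 2 := by positivity
      rw [one_div_mul_eq_div, div_le_iff₀ hpos]
      linarith [hbound (g t) (u t) (hg t ht.1)])
    (Set.right_mem_Icc.2 hT)
  have hmT : m * (π / m) = π := mul_div_cancel₀ _ hm.ne'
  simp only [neg_mul, hmT] at hle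
  linarith [neg_pi_div_two_lt_arctan (u (π / m)), arctan_lt_pi_div_two (u 0)]

/-- If `B` satisfies `B' + B² + 2g·B + k·id = 0` on `[0, ∞)` and `g² ≤ c < k` there, then `B 0`
has no real eigenvector. -/
theorem apply_ne_smul_of_operator_riccati {E : Type*} [NormedAddCommGroup E] [NormedSpace ℝ E]
    {k c : ℝ} (hk : 0 < k) (hc : c < k) {g : ℝ → ℝ} (hg_cont : Continuous g)
    (hg : ∀ t, 0 ≤ t → g t ^ 2 ≤ c) {B B' : ℝ → E →L[ℝ] E} (hB : ∀ t, HasDerivAt B (B' t) t)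
    (hRic : ∀ t, 0 ≤ t →
      B' t + B t ∘L B t + (2 * g t) • B t + k • ContinuousLinearMap.id ℝ E = 0)
    {y : E} (hy : y ≠ 0) (lam : ℝ) : B 0 y ≠ lam • y := by
  intro hlam
  obtain ⟨φ, hφy⟩ : ∃ φ : StrongDual ℝ E, φ y = 1 := by
    obtain ⟨ψ, -, hψ⟩ := exists_dual_vector ℝ y (norm_ne_zero_iff.2 hy)
    exact ⟨‖y‖⁻¹ • ψ, by simp [hψ, hy]⟩
  have hB_cont : Continuous B := continuous_iff_continuousAt.2 fun t => (hB t).continuousAt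
  -- `B y = u • y + w` with `φ w = 0`; the component `w` solves a homogeneous linear equation.
  let u : ℝ → ℝ := fun t => φ (B t y)
  let w : ℝ → E := fun t => B t y - u t • y
  have hBy : ∀ t, HasDerivAt (fun s => B s y) (B' t y) t := fun t => by
    simpa using (hB t).clm_apply (hasDerivAt_const t y)
  have hu : ∀ t, HasDerivAt u (φ (B' t y)) t := fun t =>
    φ.hasFDerivAt.comp_hasDerivAt t (hBy t)
  have hw : ∀ t, HasDerivAt w (B' t y - φ (B' t y) • y) t := fun t =>
    (hBy t).sub ((hu t).smul_const y)
  have hu_cont : Continuous u := φ.continuous.comp (hB_cont.clm_apply continuous_const)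
  have hφw : ∀ t, φ (w t) = 0 := fun t => by simp [w, u, hφy]
  have hsplit : ∀ t, B t y = u t • y + w t := fun t => by simp [w]
  have hB'y : ∀ t, 0 ≤ t → B' t y =
      -(u t ^ 2 + 2 * g t * u t + k) • y - (u t + 2 * g t) • w t - B t (w t) := fun t ht => by
    have h := congrArg (fun L : E →L[ℝ] E => L y) (hRic t ht)
    simp only [add_apply, ContinuousLinearMap.comp_apply,
      smul_apply, ContinuousLinearMap.id_apply,
      zero_apply] at h
    have hBB : B t (B t y) = u t • (u t • y + w t) + B t (w t) := by
      rw [hsplit t, map_add, map_smul, hsplit t]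
    rw [hBB, hsplit t] at h
    rw [← sub_eq_zero, ← h]
    module
  have hφB' : ∀ t, 0 ≤ t → φ (B' t y) = -(u t ^ 2 + 2 * g t * u t + k) - φ (B t (w t)) :=
    fun t ht => by simp [hB'y t ht, hφy, hφw]
  have hw0 : w 0 = 0 := by simp [w, u, hlam, hφy]
  have hw_zero : ∀ t, 0 ≤ t → w t = 0 := fun T hT => by
    obtain ⟨K, hK⟩ := (isCompact_Icc (a := (0 : ℝ)) (b := T)).exists_bound_of_continuousOn
      (f := fun t => |u t + 2 * g t| + ‖B t‖ + ‖φ‖ * ‖B t‖ * ‖y‖)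
      (by fun_prop)
    refine eq_zero_of_abs_deriv_le_mul_abs_self_of_eq_zero_right (a := 0) (b := T) (K := K)
      (fun t _ => (hw t).continuousAt.continuousWithinAt) (fun t _ => (hw t).hasDerivWithinAt)
      hw0 (fun t ht => ?_) T (Set.right_mem_Icc.2 hT)
    have hrw : B' t y - φ (B' t y) • y =
        φ (B t (w t)) • y - (u t + 2 * g t) • w t - B t (w t) := by
      rw [hφB' t ht.1, hB'y t ht.1]
      module
    have hBw : ‖B t (w t)‖ ≤ ‖B t‖ * ‖w t‖ := (B t).le_opNorm _
    calc ‖B' t y - φ (B' t y) • y‖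
        ≤ ‖φ (B t (w t))‖ * ‖y‖ + |u t + 2 * g t| * ‖w t‖ + ‖B t (w t)‖ := by
          rw [hrw, ← norm_smul, ← Real.norm_eq_abs, ← norm_smul]
          exact (norm_sub_le _ _).trans (by gcongr; exact norm_sub_le _ _)
      _ ≤ ‖φ‖ * (‖B t‖ * ‖w t‖) * ‖y‖ + |u t + 2 * g t| * ‖w t‖ + ‖B t‖ * ‖w t‖ := by
          gcongr
          exact (φ.le_opNorm _).trans (by gcongr)
      _ = (|u t + 2 * g t| + ‖B t‖ + ‖φ‖ * ‖B t‖ * ‖y‖) * ‖w t‖ := by ring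
      _ ≤ K * ‖w t‖ := by
          gcongr
          exact (le_abs_self _).trans (hK t ⟨ht.1, ht.2.le⟩)
  refine false_of_hasDerivAt_scalar_riccati hk hc hg (u := u) fun t ht => ?_
  simpa [hφB' t ht, hw_zero t ht] using hu t

/-- If `B` satisfies the weighted matrix Riccati equation `B' + B² + 2g·B + k·id = 0` on
`[0, ∞)` with `k > 0` and `g(t)² ≤ c < k` for `t ≥ 0`, then `B(0)` has no real eigenvalue;
in particular, if `n` is odd, no such `B` exists on `[0, ∞)`. -/
theorem stmt_17 {n : ℕ} (k c : ℝ) (hk : 0 < k) (hc : c < k)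
    (g : ℝ → ℝ) (hg_cont : Continuous g) (hg : ∀ t : ℝ, 0 ≤ t → g t ^ 2 ≤ c)
    (B B' : ℝ → EuclideanSpace ℝ (Fin n) →L[ℝ] EuclideanSpace ℝ (Fin n))
    (hB : ∀ t, HasDerivAt B (B' t) t)
    (hRic : ∀ t ∈ Set.Ici (0 : ℝ),
      B' t + B t ∘L B t + (2 * g t) • B t
        + k • ContinuousLinearMap.id ℝ (EuclideanSpace ℝ (Fin n)) = 0) :
    (¬ ∃ (lam₀ : ℝ) (y₀ : EuclideanSpace ℝ (Fin n)), y₀ ≠ 0 ∧ B 0 y₀ = lam₀ • y₀) ∧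
    (Odd n → False) := by
  have hno : ¬ ∃ (lam₀ : ℝ) (y₀ : EuclideanSpace ℝ (Fin n)), y₀ ≠ 0 ∧ B 0 y₀ = lam₀ • y₀ :=
    fun ⟨lam₀, _, hy₀, h⟩ =>
      apply_ne_smul_of_operator_riccati hk hc hg_cont hg hB hRic hy₀ lam₀ h
  refine ⟨hno, fun hn => hno ?_⟩
  obtain ⟨lam, hlam⟩ := LinearMap.exists_hasEigenvalue_of_odd_finrank
    (B 0 : EuclideanSpace ℝ (Fin n) →ₗ[ℝ] EuclideanSpace ℝ (Fin n)) (by simpa using hn)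
  obtain ⟨y, hy⟩ := hlam.exists_hasEigenvector
  exact ⟨lam, y, hy.2, hy.apply_eq_smul⟩
end
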